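/- arXiv:0812.2054 — 12 statements merged into one kernel-verified Lean document; each statement's English description precedes it below -/
import Mathlib

section
/- Let A = [[a,b],[c,d]] be a 2×2 matrix over the real quaternions ℍ with b = 0 or c = 0 (i.e., bc = 0). Then the set of left eigenvalues of A is exactly {a, d}. -/
open Quaternion

/-- Left eigenvalues of a lower triangular `2 × 2` matrix over a division ring. -/
theorem exists_left_eigenvector_lower_triangular_iff {K : Type*} [DivisionRing K] (a c d q : K) :
    (∃ x y : K, (x ≠ 0 ∨ y ≠ 0) ∧ a * x = q * x ∧ c * x + d * y = q * y) ↔ q = a ∨ q = d := by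
  constructor
  · rintro ⟨x, y, hxy, hx, hy⟩
    by_cases h : x = 0
    · have hy0 : y ≠ 0 := hxy.resolve_left (not_not.mpr h)
      rw [h, mul_zero, zero_add] at hy
      exact Or.inr (mul_right_cancel₀ hy0 hy).symm
    · exact Or.inl (mul_right_cancel₀ h hx).symm
  · intro hq
    by_cases h : q = d
    · exact ⟨0, 1, Or.inr one_ne_zero, by simp, by simp [h]⟩
    · obtain rfl := hq.resolve_right h
      refine ⟨1, (q - d)⁻¹ * c, Or.inl one_ne_zero, rfl, ?_⟩
      have key : (q - d) * ((q - d)⁻¹ * c) = c := mul_inv_cancel_left₀ (sub_ne_zero.mpr h) c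
      rw [sub_mul, sub_eq_iff_eq_add] at key
      rw [mul_one, key]

theorem left_eigenvalues_of_triangular
    (a b c d : ℍ[ℝ]) (hbc : b * c = 0) :
    {q : ℍ[ℝ] | ∃ u : Fin 2 → ℍ[ℝ], u ≠ 0 ∧
        a * u 0 + b * u 1 = q * u 0 ∧ c * u 0 + d * u 1 = q * u 1}
      = {a, d} := by
  ext q
  simp only [Set.mem_ofPred_eq, Set.mem_insert_iff, Set.mem_singleton_iff]
  have ne_zero_iff (u : Fin 2 → ℍ[ℝ]) : u ≠ 0 ↔ u 0 ≠ 0 ∨ u 1 ≠ 0 := by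
    rw [Function.ne_iff, Fin.exists_fin_two]
    rfl
  rcases mul_eq_zero.mp hbc with rfl | rfl
  · rw [← exists_left_eigenvector_lower_triangular_iff a c d q]
    constructor
    · rintro ⟨u, hu, h₀, h₁⟩
      exact ⟨u 0, u 1, (ne_zero_iff u).mp hu, by simpa using h₀, h₁⟩
    · rintro ⟨x, y, hxy, h₀, h₁⟩
      exact ⟨![x, y], (ne_zero_iff _).mpr hxy, by simpa using h₀, h₁⟩
  · rw [or_comm, ← exists_left_eigenvector_lower_triangular_iff d b a q]
    constructor
    · rintro ⟨u, hu, h₀, h₁⟩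
      exact ⟨u 1, u 0, ((ne_zero_iff u).mp hu).symm, by simpa using h₁, by rwa [add_comm]⟩
    · rintro ⟨x, y, hxy, h₀, h₁⟩
      exact ⟨![y, x], (ne_zero_iff _).mpr hxy.symm, (add_comm _ _).trans h₁, by simpa using h₀⟩
end

section
/- Let A = [[a,b],[c,d]] be a 2×2 matrix over the real quaternions ℍ with bc ≠ 0, and let q ∈ ℍ with q ≠ a. Then q is a left eigenvalue of A if and only if (d − q) − c·(a − q)⁻¹·b = 0. -/
open Quaternion

theorem left_eigenvalue_iff_schur_complement_zero
    (a b c d : ℍ[ℝ]) (hbc : b * c ≠ 0) (q : ℍ[ℝ]) (hq : q ≠ a) :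
    (∃ u : Fin 2 → ℍ[ℝ], u ≠ 0 ∧
        a * u 0 + b * u 1 = q * u 0 ∧ c * u 0 + d * u 1 = q * u 1)
      ↔ (d - q) - c * (a - q)⁻¹ * b = 0 := by
  have ha : a - q ≠ 0 := sub_ne_zero.mpr hq.symm
  constructor
  · rintro ⟨u, hu, h₀, h₁⟩
    have hu₀ : u 0 = -((a - q)⁻¹ * (b * u 1)) := by
      have h : (a - q) * u 0 = -(b * u 1) := by
        rw [sub_mul, ← h₀]; abel
      rw [← mul_neg, ← h, inv_mul_cancel_left₀ ha]
    have hu₁ : u 1 ≠ 0 := by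
      intro h
      apply hu
      ext1 i
      fin_cases i
      · simpa [h] using hu₀
      · exact h
    refine (mul_eq_zero.mp ?_).resolve_right hu₁
    calc (d - q - c * (a - q)⁻¹ * b) * u 1
        = c * -((a - q)⁻¹ * (b * u 1)) + d * u 1 - q * u 1 := by noncomm_ring
      _ = 0 := by rw [← hu₀, h₁, sub_self]
  · intro h
    refine ⟨![-((a - q)⁻¹ * b), 1], fun hu => one_ne_zero (congrFun hu 1), ?_, ?_⟩
    · simp only [Matrix.cons_val_zero, Matrix.cons_val_one, mul_one]
      rw [← sub_eq_zero]
      calc a * -((a - q)⁻¹ * b) + b - q * -((a - q)⁻¹ * b)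
          = b - (a - q) * ((a - q)⁻¹ * b) := by rw [sub_mul, mul_neg, mul_neg]; abel
        _ = 0 := by rw [mul_inv_cancel_left₀ ha, sub_self]
    · simp only [Matrix.cons_val_zero, Matrix.cons_val_one, mul_one]
      rw [← sub_eq_zero, ← h, mul_neg, mul_assoc]
      abel
end

section
/- Let A = [[a,b],[c,d]] be a 2×2 matrix over the real quaternions ℍ with bc ≠ 0, and set a₁ = b⁻¹(a − d) and a₀ = −b⁻¹c. Then a quaternion q is a left eigenvalue of A if and only if q = a + b·p for some quaternion p satisfying p² + a₁·p + a₀ = 0. -/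
open Quaternion

theorem inv_mul_quadratic_eq_zero_iff {K : Type*} [DivisionRing K] {b : K} (hb : b ≠ 0)
    (a c d p : K) :
    p ^ 2 + (b⁻¹ * (a - d)) * p + (-(b⁻¹ * c)) = 0 ↔ c + d * p = (a + b * p) * p := by
  have key : p ^ 2 + (b⁻¹ * (a - d)) * p + (-(b⁻¹ * c)) =
      b⁻¹ * ((a + b * p) * p - (c + d * p)) := by
    have hp : b⁻¹ * (b * p * p) = p ^ 2 := by
      rw [mul_assoc b, inv_mul_cancel_left₀ hb, sq]
    rw [← hp]
    noncomm_ring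
  rw [key, mul_eq_zero, or_iff_right (inv_ne_zero hb), sub_eq_zero, eq_comm]

theorem left_eigenvalue_iff_quadratic
    (a b c d : ℍ[ℝ]) (hbc : b * c ≠ 0) (q : ℍ[ℝ]) :
    (∃ u : Fin 2 → ℍ[ℝ], u ≠ 0 ∧
        a * u 0 + b * u 1 = q * u 0 ∧ c * u 0 + d * u 1 = q * u 1)
      ↔ ∃ p : ℍ[ℝ], p ^ 2 + (b⁻¹ * (a - d)) * p + (-(b⁻¹ * c)) = 0 ∧ q = a + b * p := by
  have hb : b ≠ 0 := left_ne_zero_of_mul hbc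
  simp only [inv_mul_quadratic_eq_zero_iff hb]
  constructor
  · rintro ⟨u, hu, h₁, h₂⟩
    have h₀ : u 0 ≠ 0 := by
      intro h₀
      have hu₁ : u 1 = 0 := by simpa [h₀, hb] using h₁
      exact hu (by ext1 i; fin_cases i <;> assumption)
    have hq : q = a + b * (u 1 * (u 0)⁻¹) := by
      rw [← mul_left_inj' h₀, ← h₁, add_mul, mul_assoc b, inv_mul_cancel_right₀ h₀]
    refine ⟨u 1 * (u 0)⁻¹, ?_, hq⟩
    rw [← hq, ← mul_left_inj' h₀, add_mul, mul_assoc d, mul_assoc q,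
      inv_mul_cancel_right₀ h₀, h₂]
  · rintro ⟨p, hp, rfl⟩
    exact ⟨![1, p], fun h => one_ne_zero (congrFun h 0), by simp, by simpa using hp⟩
end

section
/- Let a₁, a₀ ∈ ℍ. The set of solutions p ∈ ℍ of the unilateral quadratic equation p² + a₁·p + a₀ = 0 is infinite if and only if a₁ and a₀ are real numbers, a₀ ≠ 0, and a₁² − 4a₀ < 0. -/
open Quaternion

namespace Quaternion

open Polynomial in
lemma finite_setOf_quadratic_eq_zero (B C : ℝ) : {n : ℝ | n ^ 2 + B * n + C = 0}.Finite := by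
  have hP : (X ^ 2 + Polynomial.C B * X + Polynomial.C C : ℝ[X]).Monic := by monicity!
  refine (Polynomial.finite_setOfPred_isRoot hP.ne_zero).subset fun n hn => ?_
  simpa [Polynomial.IsRoot] using hn

open Polynomial in
lemma finite_setOf_sextic_eq_zero (K c m : ℝ) :
    {T : ℝ | (T ^ 3 + T * K) ^ 2 - c ^ 2 - 4 * T ^ 2 * m = 0}.Finite := by
  have hP : (X ^ 6 + Polynomial.C (2 * K) * X ^ 4 + Polynomial.C (K ^ 2 - 4 * m) * X ^ 2
      + Polynomial.C (-c ^ 2) : ℝ[X]).Monic := by monicity!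
  refine (Polynomial.finite_setOfPred_isRoot hP.ne_zero).subset fun T hT => ?_
  simp only [Set.mem_ofPred_eq, Polynomial.IsRoot, eval_add, eval_mul, eval_pow, eval_X,
    eval_C] at hT ⊢
  linear_combination hT

/-- A quaternion is a root of its own real characteristic polynomial. -/
lemma sq_eq_trace_mul_sub_normSq (q : ℍ[ℝ]) :
    q ^ 2 = ((2 * q.re : ℝ) : ℍ[ℝ]) * q - ((normSq q : ℝ) : ℍ[ℝ]) := by
  rw [sq, normSq_def']
  ext <;> simp [-coe_mul, -coe_add, -coe_pow] <;> ring

/-- A root of `q ^ 2 + v * q + b` has trace and norm constrained by two real equations. -/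
lemma trace_normSq_of_root {v b q : ℍ[ℝ]} (hv : v.re = 0) (h : q ^ 2 + v * q + b = 0) :
    (((2 * q.re) ^ 3 + 2 * q.re * (normSq v + 2 * b.re)) ^ 2
        - (2 * (v.imI * b.imI + v.imJ * b.imJ + v.imK * b.imK)) ^ 2
        - 4 * (2 * q.re) ^ 2 * normSq b = 0) ∧
      normSq q ^ 2 + -(2 * b.re + normSq v + (2 * q.re) ^ 2) * normSq q + normSq b = 0 := by
  rw [sq_eq_trace_mul_sub_normSq] at h
  have h0 := congrArg QuaternionAlgebra.re h
  have h1 := congrArg QuaternionAlgebra.imI h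
  have h2 := congrArg QuaternionAlgebra.imJ h
  have h3 := congrArg QuaternionAlgebra.imK h
  have hN := normSq_def' q
  have hV := normSq_def' v
  have hb := normSq_def' b
  simp [hv, -coe_mul] at h0 h1 h2 h3 hV
  generalize normSq q = N at *
  generalize normSq v = V at *
  generalize normSq b = m at *
  obtain ⟨x, y, z, w⟩ := q
  obtain ⟨v0, v1, v2, v3⟩ := v
  obtain ⟨b0, b1, b2, b3⟩ := b
  simp only at *
  have htr : 2 * x * (V + (2 * x) ^ 2)
      = 2 * (2 * x) * N - 2 * (2 * x) * b0 - 2 * (v1 * b1 + v2 * b2 + v3 * b3) := by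
    rw [hV]
    linear_combination 2 * (2 * x * h0 + v1 * h1 + v2 * h2 + v3 * h3)
  have hnm : N ^ 2 + -(2 * b0 + V + (2 * x) ^ 2) * N + m = 0 := by
    rw [hb]
    have e : (N - b0) ^ 2 + b1 ^ 2 + b2 ^ 2 + b3 ^ 2 = (V + (2 * x) ^ 2) * N := by
      rw [hV]
      linear_combination
        -((2 * x * x + (-(v1 * y) - v2 * z - v3 * w)) + (N - b0)) * h0
          - ((2 * x * y + (v1 * x + v2 * w - v3 * z)) - b1) * h1
          - ((2 * x * z + (-(v1 * w) + v2 * x + v3 * y)) - b2) * h2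
          - ((2 * x * w + (v1 * z - v2 * y + v3 * x)) - b3) * h3
          - (v1 ^ 2 + v2 ^ 2 + v3 ^ 2 + (2 * x) ^ 2) * hN
    linear_combination e
  refine ⟨?_, hnm⟩
  linear_combination -(4 * (2 * x) ^ 2) * hnm
    - (2 * (2 * x) * N - ((2 * x) ^ 3 + 2 * x * (V + 2 * b0))
      + 2 * (v1 * b1 + v2 * b2 + v3 * b3)) * htr

lemma finite_roots_of_re_eq_zero {v b : ℍ[ℝ]} (hv : v.re = 0)
    (hne : v ≠ 0 ∨ ∀ s : ℝ, b ≠ s) : {q : ℍ[ℝ] | q ^ 2 + v * q + b = 0}.Finite := by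
  refine ((finite_setOf_sextic_eq_zero (normSq v + 2 * b.re)
    (2 * (v.imI * b.imI + v.imJ * b.imJ + v.imK * b.imK)) (normSq b)).biUnion fun T _ =>
    (finite_setOf_quadratic_eq_zero (-(2 * b.re + normSq v + T ^ 2)) (normSq b)).biUnion
      fun N _ => Set.Subsingleton.finite (s := {q : ℍ[ℝ] |
        q ^ 2 + v * q + b = 0 ∧ 2 * q.re = T ∧ normSq q = N}) ?_).subset ?_
  · rintro p ⟨hp, hpT, hpN⟩ q ⟨hq, hqT, hqN⟩
    rw [sq_eq_trace_mul_sub_normSq, hpT, hpN] at hp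
    rw [sq_eq_trace_mul_sub_normSq, hqT, hqN] at hq
    have key : ((T : ℍ[ℝ]) + v) * (p - q) = 0 := by
      calc ((T : ℍ[ℝ]) + v) * (p - q)
          = ((T : ℍ[ℝ]) * p - (N : ℍ[ℝ]) + v * p + b)
            - ((T : ℍ[ℝ]) * q - (N : ℍ[ℝ]) + v * q + b) := by noncomm_ring
        _ = 0 := by rw [hp, hq, sub_zero]
    rcases mul_eq_zero.mp key with h | h
    · have hT : T = 0 := by simpa [hv] using congrArg QuaternionAlgebra.re h
      have hv0 : v = 0 := by simpa [hT] using h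
      rcases hne with hne | hne
      · exact absurd hv0 hne
      · refine absurd ?_ (hne N)
        exact (neg_add_eq_zero.mp (by simpa [hT, hv0] using hp)).symm
    · exact sub_eq_zero.mp h
  · intro q hq
    obtain ⟨h1, h2⟩ := trace_normSq_of_root hv hq
    simp only [Set.mem_iUnion]
    exact ⟨_, h1, _, h2, hq, rfl, rfl⟩

lemma finite_setOf_sq_add_coe_eq_zero {s : ℝ} (hs : s ≤ 0) :
    {q : ℍ[ℝ] | q ^ 2 + (s : ℍ[ℝ]) = 0}.Finite := by
  refine (Set.toFinite {((√(-s) : ℝ) : ℍ[ℝ]), -((√(-s) : ℝ) : ℍ[ℝ])}).subset fun q hq => ?_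
  have h : q ^ 2 = ((√(-s) : ℝ) : ℍ[ℝ]) ^ 2 := by
    rw [← coe_pow, Real.sq_sqrt (neg_nonneg.mpr hs), coe_neg]
    exact eq_neg_of_add_eq_zero_left hq
  exact (coe_commute (√(-s)) q).symm.sq_eq_sq_iff_eq_or_eq_neg.mp h

/-- Completing the square in the real part of the linear coefficient. -/
lemma finite_roots_of_finite_shifted {a₁ a₀ : ℍ[ℝ]}
    (h : {q : ℍ[ℝ] | q ^ 2 + a₁.im * q
      + (a₀ - ((a₁.re / 2 : ℝ) : ℍ[ℝ]) * a₁.im - ((a₁.re ^ 2 / 4 : ℝ) : ℍ[ℝ])) = 0}.Finite) :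
    {p : ℍ[ℝ] | p ^ 2 + a₁ * p + a₀ = 0}.Finite := by
  refine (h.preimage (add_left_injective ((a₁.re / 2 : ℝ) : ℍ[ℝ])).injOn).subset fun p hp => ?_
  simp only [Set.mem_preimage, Set.mem_ofPred_eq] at hp ⊢
  rw [← hp]
  simp only [sq]
  ext <;> simp [-coe_div, -coe_mul, -coe_pow] <;> ring

lemma infinite_roots_of_discrim_neg {t s : ℝ} (h : t ^ 2 - 4 * s < 0) :
    {p : ℍ[ℝ] | p ^ 2 + (t : ℍ[ℝ]) * p + (s : ℍ[ℝ]) = 0}.Infinite := by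
  have hd : 0 < s - t ^ 2 / 4 := by linarith
  refine Set.infinite_of_injOn_mapsTo
    (f := fun u : ℝ => (⟨-t / 2, u, √(s - t ^ 2 / 4 - u ^ 2), 0⟩ : ℍ[ℝ]))
    (fun u _ w _ huw => congrArg QuaternionAlgebra.imI huw) ?_
    (Set.Icc_infinite (Real.sqrt_pos.mpr hd))
  intro u hu
  have hsq := Real.sq_sqrt (sub_nonneg.mpr ((Real.le_sqrt hu.1 hd.le).mp hu.2))
  have root : ∀ p : ℍ[ℝ], p.re = -t / 2 → p.imI = u → p.imJ = √(s - t ^ 2 / 4 - u ^ 2) →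
      p.imK = 0 → p ^ 2 + (t : ℍ[ℝ]) * p + (s : ℍ[ℝ]) = 0 := by
    intro p h0 h1 h2 h3
    rw [sq]
    ext <;> simp [h0, h1, h2, h3] <;> linarith
  exact root _ rfl rfl rfl rfl

end Quaternion

theorem quadratic_infinitely_many_solutions_iff
    (a₁ a₀ : ℍ[ℝ]) :
    {p : ℍ[ℝ] | p ^ 2 + a₁ * p + a₀ = 0}.Infinite
      ↔ ∃ t s : ℝ, a₁ = (t : ℍ[ℝ]) ∧ a₀ = (s : ℍ[ℝ]) ∧ s ≠ 0 ∧ t ^ 2 - 4 * s < 0 := by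
  constructor
  · contrapose!
    intro h
    apply Quaternion.finite_roots_of_finite_shifted
    by_cases hne : a₁.im ≠ 0 ∨ ∀ s : ℝ, a₀ ≠ s
    · refine Quaternion.finite_roots_of_re_eq_zero (Quaternion.re_im a₁) ?_
      by_cases him : a₁.im = 0
      · refine Or.inr fun s hs => (hne.resolve_left (not_not.mpr him)) (s + a₁.re ^ 2 / 4) ?_
        rw [Quaternion.coe_add, ← hs, him]
        simp
      · exact Or.inl him
    · push Not at hne
      obtain ⟨him, s, hs⟩ := hne
      have ht : a₁ = (a₁.re : ℍ[ℝ]) := by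
        simpa [him] using (Quaternion.re_add_im a₁).symm
      have hle : 0 ≤ a₁.re ^ 2 - 4 * s := by
        by_cases hs0 : s = 0
        · rw [hs0]; nlinarith [sq_nonneg a₁.re]
        · exact h _ s ht hs hs0
      have hfin := Quaternion.finite_setOf_sq_add_coe_eq_zero
        (s := s - a₁.re ^ 2 / 4) (by linarith)
      simpa [him, hs] using hfin
  · rintro ⟨t, s, rfl, rfl, -, h⟩
    exact Quaternion.infinite_roots_of_discrim_neg h
end

section
/- Let a₁, a₀ ∈ ℍ. The set of solutions p ∈ ℍ of the unilateral quadratic equation p² + a₁·p + a₀ = 0 is nonempty, and it either has exactly one element, exactly two elements, or is infinite. -/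
open Quaternion

/-- The real quaternions as a right complex vector space. -/
noncomputable abbrev rightComplexModule : Module ℂ ℍ[ℝ] :=
  Module.compHom ℍ[ℝ] (RingHom.toOpposite (Quaternion.ofComplex : ℂ →+* ℍ[ℝ])
    fun x y => by
      simp only [Commute, SemiconjBy, ← map_mul]
      rw [mul_comm])

/-- A quadratic with left quaternionic coefficients has a complex right eigenvalue. -/
theorem exists_right_eigenvector (b c : ℍ[ℝ]) :
    ∃ x l : ℍ[ℝ], x ≠ 0 ∧ x * l * l + b * (x * l) + c * x = 0 := by
  let := rightComplexModule
  have hsmul : ∀ (z : ℂ) (x : ℍ[ℝ]), z • x = x * (z : ℍ[ℝ]) := fun z x => rfl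
  have htower : IsScalarTower ℝ ℂ ℍ[ℝ] := ⟨fun r z x => by
    rw [hsmul, hsmul, ← mul_smul_comm]; congr 1; exact map_smul Quaternion.ofComplex r z⟩
  have : Module.Finite ℂ ℍ[ℝ] := Module.Finite.of_restrictScalars_finite ℝ ℂ ℍ[ℝ]
  let T : Module.End ℂ (ℍ[ℝ] × ℍ[ℝ]) :=
    { toFun := fun v => (v.2, -(c * v.1) - b * v.2)
      map_add' := fun v w => by
        ext1
        · rfl
        · simp only [Prod.fst_add, Prod.snd_add, mul_add]; abel
      map_smul' := fun z v => by
        ext1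
        · rfl
        · simp only [Prod.smul_fst, Prod.smul_snd, hsmul, RingHom.id_apply, sub_mul, neg_mul,
            mul_assoc] }
  obtain ⟨μ, hμ⟩ := Module.End.exists_eigenvalue T
  obtain ⟨v, hv⟩ := hμ.exists_hasEigenvector
  have h := hv.apply_eq_smul
  have h1 : v.2 = v.1 * (μ : ℍ[ℝ]) := congrArg Prod.fst h
  have h2 : -(c * v.1) - b * v.2 = v.2 * (μ : ℍ[ℝ]) := congrArg Prod.snd h
  refine ⟨v.1, μ, fun h0 => hv.2 (Prod.ext h0 (by rw [h1, h0, zero_mul]; rfl)), ?_⟩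
  rw [← h1, ← h2]
  abel

theorem exists_quadratic_root (b c : ℍ[ℝ]) : ∃ p : ℍ[ℝ], p ^ 2 + b * p + c = 0 := by
  obtain ⟨x, l, hx, h⟩ := exists_right_eigenvector b c
  refine ⟨x * l * x⁻¹, mul_right_cancel₀ hx ?_⟩
  rw [zero_mul, ← h]
  simp only [sq, add_mul, mul_assoc, inv_mul_cancel₀ hx, mul_one, inv_mul_cancel_left₀ hx]

/-- The inverses of the differences between a root and the other roots solve a linear equation. -/
theorem quadratic_root_add_inv_iff {b c p w : ℍ[ℝ]} (hp : p ^ 2 + b * p + c = 0) (hw : w ≠ 0) :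
    (p + w⁻¹) ^ 2 + b * (p + w⁻¹) + c = 0 ↔ w * (p + b) + p * w = -1 := by
  have key : w * ((p + w⁻¹) ^ 2 + b * (p + w⁻¹) + c) * w = w * (p + b) + p * w + 1 := by
    have e : (p + w⁻¹) ^ 2 + b * (p + w⁻¹) + c =
        (p ^ 2 + b * p + c) + (p * w⁻¹ + w⁻¹ * p + w⁻¹ * w⁻¹ + b * w⁻¹) := by
      noncomm_ring
    rw [e, hp, zero_add]
    simp only [mul_add, add_mul, mul_assoc, inv_mul_cancel₀ hw, mul_one,
      mul_inv_cancel_left₀ hw]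
    abel
  rw [← add_eq_zero_iff_eq_neg, ← key]
  simp [hw]

theorem quadratic_roots_infinite {b c p q r : ℍ[ℝ]} (hp : p ^ 2 + b * p + c = 0)
    (hq : q ^ 2 + b * q + c = 0) (hr : r ^ 2 + b * r + c = 0)
    (hqp : q ≠ p) (hrp : r ≠ p) (hqr : q ≠ r) :
    {x : ℍ[ℝ] | x ^ 2 + b * x + c = 0}.Infinite := by
  have linear : ∀ s : ℍ[ℝ], s ^ 2 + b * s + c = 0 → s ≠ p →
      (s - p)⁻¹ * (p + b) + p * (s - p)⁻¹ = -1 := fun s hs hsp =>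
    (quadratic_root_add_inv_iff hp (inv_ne_zero (sub_ne_zero.2 hsp))).1 (by simpa using hs)
  have hu := linear q hq hqp
  have hv := linear r hr hrp
  have huv : (q - p)⁻¹ - (r - p)⁻¹ ≠ 0 := fun h => hqr (by simpa [sub_eq_zero] using h)
  generalize (q - p)⁻¹ = u at *
  generalize (r - p)⁻¹ = v at *
  have hline : ∀ t : ℝ, (v + t • (u - v)) * (p + b) + p * (v + t • (u - v)) = -1 := fun t => by
    have : (v + t • (u - v)) * (p + b) + p * (v + t • (u - v)) =
        (v * (p + b) + p * v) + t • ((u * (p + b) + p * u) - (v * (p + b) + p * v)) := by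
      simp only [add_mul _ _ (p + b), mul_add p, smul_mul_assoc, mul_smul_comm, sub_mul, mul_sub,
        smul_sub, smul_add]
      abel
    rw [this, hu, hv, sub_self, smul_zero, add_zero]
  refine Set.infinite_of_injective_forall_mem (f := fun t : ℝ => p + (v + t • (u - v))⁻¹) ?_ ?_
  · intro s t hst
    exact smul_left_injective ℝ huv (add_left_cancel (inv_injective (add_left_cancel hst)))
  · intro t
    refine (quadratic_root_add_inv_iff hp fun h => ?_).2 (hline t)
    have := hline t
    simp [h] at this

theorem quadratic_one_two_or_infinite_solutions
    (a₁ a₀ : ℍ[ℝ]) :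
    {p : ℍ[ℝ] | p ^ 2 + a₁ * p + a₀ = 0}.Nonempty ∧
      ({p : ℍ[ℝ] | p ^ 2 + a₁ * p + a₀ = 0}.ncard = 1 ∨
       {p : ℍ[ℝ] | p ^ 2 + a₁ * p + a₀ = 0}.ncard = 2 ∨
       {p : ℍ[ℝ] | p ^ 2 + a₁ * p + a₀ = 0}.Infinite) := by
  have hne : {p : ℍ[ℝ] | p ^ 2 + a₁ * p + a₀ = 0}.Nonempty := exists_quadratic_root a₁ a₀
  refine ⟨hne, ?_⟩
  by_cases hfin : {p : ℍ[ℝ] | p ^ 2 + a₁ * p + a₀ = 0}.Finite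
  · have hpos := (Set.ncard_pos hfin).2 hne
    have hle : {p : ℍ[ℝ] | p ^ 2 + a₁ * p + a₀ = 0}.ncard ≤ 2 := by
      by_contra! h
      obtain ⟨p, q, r, hp, hq, hr, hpq, hpr, hqr⟩ := (Set.two_lt_ncard_iff hfin).1 h
      exact quadratic_roots_infinite hp hq hr hpq.symm hpr.symm hqr hfin
    lia
  · exact Or.inr (Or.inr hfin)
end

section
/- A 2×2 matrix A over the real quaternions ℍ has at least one left eigenvalue, and its set of left eigenvalues either has exactly one element, exactly two elements, or is infinite. -/
open Quaternion

namespace Quaternion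

/-- Every monic quadratic equation with left coefficients has a root in `ℍ`. -/
theorem exists_quadratic_eq_zero (P Q : ℍ[ℝ]) : ∃ x : ℍ[ℝ], x * x + P * x + Q = 0 := by
  let φ : ℂ →+* ℍ[ℝ]ᵐᵒᵖ := ofComplex.toRingHom.toOpposite fun x y ↦
    (Commute.all x y).map ofComplex
  let _ : Module ℂ (ℍ[ℝ] × ℍ[ℝ]) := Module.compHom _ φ
  have smul_def (z : ℂ) (v : ℍ[ℝ] × ℍ[ℝ]) : z • v = (v.1 * (z : ℍ[ℝ]), v.2 * (z : ℍ[ℝ])) := rfl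
  have : IsScalarTower ℝ ℂ (ℍ[ℝ] × ℍ[ℝ]) := ⟨fun r z v ↦ by
    ext1 <;> simp [smul_def, ← coe_mul_eq_smul, mul_assoc, coe_commutes]⟩
  have : Module.Finite ℂ (ℍ[ℝ] × ℍ[ℝ]) := Module.Finite.of_restrictScalars_finite ℝ ℂ _
  let T : Module.End ℂ (ℍ[ℝ] × ℍ[ℝ]) :=
    { toFun v := (v.2, -(Q * v.1) - P * v.2)
      map_add' v w := by ext1 <;> simp only [Prod.fst_add, Prod.snd_add] <;> noncomm_ring
      map_smul' z v := by
        ext1 <;> simp only [smul_def, RingHom.id_apply] <;> noncomm_ring }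
  obtain ⟨z, hz⟩ := Module.End.exists_eigenvalue T
  obtain ⟨v, hv⟩ := hz.exists_hasEigenvector
  have h := hv.apply_eq_smul
  have h₁ : v.2 = v.1 * (z : ℍ[ℝ]) := congrArg Prod.fst h
  have h₂ : -(Q * v.1) - P * v.2 = v.2 * (z : ℍ[ℝ]) := congrArg Prod.snd h
  have h₀ : v.1 ≠ 0 := fun h₀ ↦ hv.2 (Prod.ext h₀ (by simp [h₁, h₀]))
  refine ⟨v.1 * z * v.1⁻¹, mul_right_cancel₀ h₀ ?_⟩
  rw [h₁] at h₂
  calc (v.1 * z * v.1⁻¹ * (v.1 * z * v.1⁻¹) + P * (v.1 * z * v.1⁻¹) + Q) * v.1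
      = v.1 * z * (v.1⁻¹ * v.1) * z * (v.1⁻¹ * v.1) + P * (v.1 * z) * (v.1⁻¹ * v.1) + Q * v.1 := by
        noncomm_ring
    _ = 0 * v.1 := by
        rw [inv_mul_cancel₀ h₀, mul_one, mul_one, mul_one, ← h₂]
        noncomm_ring

theorem mul_self_eq (x : ℍ[ℝ]) :
    x * x = ((2 * x.re : ℝ) : ℍ[ℝ]) * x - ((normSq x : ℝ) : ℍ[ℝ]) := by
  have h := normSq_def' x
  generalize normSq x = n at h ⊢
  ext <;> simp <;> linarith

theorem re_mul_comm (x y : ℍ[ℝ]) : (x * y).re = (y * x).re := by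
  simp; ring

/-- There are infinitely many quaternions sharing real part and norm with a nonreal one. -/
theorem infinite_setOf_re_eq_normSq_eq {r n : ℝ} (h : r ^ 2 < n) :
    {x : ℍ[ℝ] | x.re = r ∧ normSq x = n}.Infinite := by
  have hs : 0 < √(n - r ^ 2) := Real.sqrt_pos.2 (sub_pos.2 h)
  let g : ℝ → ℍ[ℝ] := fun v ↦ ⟨r, v, √(n - r ^ 2 - v ^ 2), 0⟩
  have hg : Function.Injective g := fun v w hvw ↦ congrArg (fun x : ℍ[ℝ] ↦ x.imI) hvw
  refine ((Set.Icc_infinite hs).image hg.injOn).mono ?_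
  rintro _ ⟨v, ⟨hv₀, hv⟩, rfl⟩
  have hv' : v ^ 2 ≤ n - r ^ 2 := (Real.le_sqrt hv₀ (sub_pos.2 h).le).1 hv
  refine ⟨rfl, ?_⟩
  rw [normSq_def']
  simp only [g, Real.sq_sqrt (sub_nonneg.2 hv')]
  ring

/-- A root of a quadratic other than a given root `x` is conjugate to `-(x + P)`. -/
theorem re_eq_and_normSq_eq_of_quadratic {P Q x y : ℍ[ℝ]} (hx : x * x + P * x + Q = 0)
    (hy : y * y + P * y + Q = 0) (hxy : y ≠ x) :
    y.re = (-(x + P)).re ∧ normSq y = normSq (-(x + P)) := by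
  have h : (y - x) * y = -(x + P) * (y - x) := by
    rw [← sub_eq_zero]
    calc (y - x) * y - -(x + P) * (y - x) = (y * y + P * y + Q) - (x * x + P * x + Q) := by
          noncomm_ring
      _ = 0 := by rw [hx, hy, sub_zero]
  have h₀ : y - x ≠ 0 := sub_ne_zero.2 hxy
  constructor
  · calc y.re = ((y - x)⁻¹ * ((y - x) * y)).re := by rw [inv_mul_cancel_left₀ h₀]
      _ = (-(x + P)).re := by rw [re_mul_comm, h, mul_inv_cancel_right₀ h₀]
  · have hn := congrArg normSq h
    rw [map_mul, map_mul, mul_comm] at hn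
    exact mul_right_cancel₀ (normSq_ne_zero.2 h₀) hn

/-- A quadratic with three distinct roots in `ℍ` has infinitely many. -/
theorem infinite_setOf_quadratic {P Q x y z : ℍ[ℝ]} (hx : x * x + P * x + Q = 0)
    (hy : y * y + P * y + Q = 0) (hz : z * z + P * z + Q = 0) (hyx : y ≠ x) (hzx : z ≠ x)
    (hyz : y ≠ z) : {x : ℍ[ℝ] | x * x + P * x + Q = 0}.Infinite := by
  obtain ⟨hy₁, hy₂⟩ := re_eq_and_normSq_eq_of_quadratic hx hy hyx
  obtain ⟨hz₁, hz₂⟩ := re_eq_and_normSq_eq_of_quadratic hx hz hzx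
  have hre : z.re = y.re := hz₁.trans hy₁.symm
  have hn : normSq z = normSq y := hz₂.trans hy₂.symm
  have hzz := mul_self_eq z
  rw [hre, hn] at hzz
  rw [hzz] at hz
  have hy' := hy
  rw [mul_self_eq y] at hy'
  have hP : ((2 * y.re : ℝ) : ℍ[ℝ]) + P = 0 := by
    refine (mul_eq_zero.1 (?_ : _ * (y - z) = 0)).resolve_right (sub_ne_zero.2 hyz)
    have h := congrArg₂ (· - ·) hy' hz
    simp only [sub_self] at h
    rw [← h]
    noncomm_ring
  have hQ : Q = ((normSq y : ℝ) : ℍ[ℝ]) := by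
    rw [← sub_eq_zero, ← hy', eq_neg_of_add_eq_zero_right hP]
    noncomm_ring
  have hlt : y.re ^ 2 < normSq y := by
    by_contra! hle
    have key (w : ℍ[ℝ]) (h₁ : w.re = y.re) (h₂ : normSq w = normSq y) :
        w = (y.re : ℍ[ℝ]) := by
      rw [← h₂, ← h₁, normSq_def'] at hle
      ext
      · simpa using h₁
      · simp only [imI_coe]; nlinarith [sq_nonneg w.imI, sq_nonneg w.imJ, sq_nonneg w.imK]
      · simp only [imJ_coe]; nlinarith [sq_nonneg w.imI, sq_nonneg w.imJ, sq_nonneg w.imK]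
      · simp only [imK_coe]; nlinarith [sq_nonneg w.imI, sq_nonneg w.imJ, sq_nonneg w.imK]
    exact hyz ((key y rfl rfl).trans (key z hre hn).symm)
  refine (infinite_setOf_re_eq_normSq_eq hlt).mono ?_
  rintro w ⟨h₁, h₂⟩
  rw [Set.mem_ofPred_eq, mul_self_eq w, h₁, h₂, hQ, eq_neg_of_add_eq_zero_right hP]
  noncomm_ring

/-- The root set of a monic quadratic with left coefficients in `ℍ`. -/
theorem ncard_setOf_quadratic (P Q : ℍ[ℝ]) :
    {x : ℍ[ℝ] | x * x + P * x + Q = 0}.ncard = 1 ∨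
      {x : ℍ[ℝ] | x * x + P * x + Q = 0}.ncard = 2 ∨
      {x : ℍ[ℝ] | x * x + P * x + Q = 0}.Infinite := by
  by_cases hfin : {x : ℍ[ℝ] | x * x + P * x + Q = 0}.Finite
  · have hpos := (Set.ncard_pos hfin).2 (exists_quadratic_eq_zero P Q)
    have hle : {x : ℍ[ℝ] | x * x + P * x + Q = 0}.ncard ≤ 2 := by
      by_contra! hlt
      obtain ⟨x, y, z, hx, hy, hz, hxy, hxz, hyz⟩ := (Set.two_lt_ncard_iff hfin).1 hlt
      exact infinite_setOf_quadratic hx hy hz hxy.symm hxz.symm hyz hfin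
    omega
  · exact Or.inr (Or.inr hfin)

end Quaternion

/-- The left eigenvalues of a lower triangular matrix are its diagonal entries. -/
theorem setOf_left_eigenvalue_of_triangular {A : Matrix (Fin 2) (Fin 2) ℍ[ℝ]} (hb : A 0 1 = 0) :
    {q : ℍ[ℝ] | ∃ u : Fin 2 → ℍ[ℝ], u ≠ 0 ∧
        A 0 0 * u 0 + A 0 1 * u 1 = q * u 0 ∧
        A 1 0 * u 0 + A 1 1 * u 1 = q * u 1} = {A 0 0, A 1 1} := by
  ext q
  simp only [hb, zero_mul, add_zero, Set.mem_ofPred_eq, Set.mem_insert_iff, Set.mem_singleton_iff]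
  constructor
  · rintro ⟨u, hu, h₁, h₂⟩
    by_cases h₀ : u 0 = 0
    · have hu₁ : u 1 ≠ 0 := fun hu₁ ↦ hu (by ext1 i; fin_cases i <;> assumption)
      rw [h₀, mul_zero, zero_add] at h₂
      exact Or.inr (mul_right_cancel₀ hu₁ h₂).symm
    · exact Or.inl (mul_right_cancel₀ h₀ h₁).symm
  · intro h
    by_cases hq : q = A 1 1
    · exact ⟨![0, 1], fun h ↦ one_ne_zero (congrFun h 1), by simp, by simp [hq]⟩
    · obtain rfl := h.resolve_right hq
      refine ⟨![1, (A 0 0 - A 1 1)⁻¹ * A 1 0], fun h ↦ one_ne_zero (congrFun h 0), by simp, ?_⟩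
      have hinv := mul_inv_cancel_left₀ (sub_ne_zero.2 hq) (A 1 0)
      rw [sub_mul, sub_eq_iff_eq_add] at hinv
      simpa using hinv.symm

/-- If the upper right entry is nonzero, left eigenvalues correspond to roots of a quadratic. -/
theorem setOf_left_eigenvalue_eq_image {A : Matrix (Fin 2) (Fin 2) ℍ[ℝ]} (hb : A 0 1 ≠ 0) :
    {q : ℍ[ℝ] | ∃ u : Fin 2 → ℍ[ℝ], u ≠ 0 ∧
        A 0 0 * u 0 + A 0 1 * u 1 = q * u 0 ∧
        A 1 0 * u 0 + A 1 1 * u 1 = q * u 1} =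
      (fun x ↦ A 0 0 + A 0 1 * x) '' {x : ℍ[ℝ] | x * x + (A 0 1)⁻¹ * (A 0 0 - A 1 1) * x +
        -((A 0 1)⁻¹ * A 1 0) = 0} := by
  have key (x : ℍ[ℝ]) :
      x * x + (A 0 1)⁻¹ * (A 0 0 - A 1 1) * x + -((A 0 1)⁻¹ * A 1 0) = 0 ↔
        A 1 0 + A 1 1 * x = (A 0 0 + A 0 1 * x) * x := by
    have : A 0 1 * (x * x + (A 0 1)⁻¹ * (A 0 0 - A 1 1) * x + -((A 0 1)⁻¹ * A 1 0)) =
        (A 0 0 + A 0 1 * x) * x - (A 1 0 + A 1 1 * x) := by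
      rw [mul_add, mul_add, mul_neg, mul_assoc (A 0 1)⁻¹, mul_inv_cancel_left₀ hb,
        mul_inv_cancel_left₀ hb]
      noncomm_ring
    rw [eq_comm (a := A 1 0 + _), ← sub_eq_zero (a := (A 0 0 + _) * x), ← this, mul_eq_zero,
      or_iff_right hb]
  ext q
  simp only [Set.mem_ofPred_eq, Set.mem_image, key]
  constructor
  · rintro ⟨u, hu, h₁, h₂⟩
    have h₀ : u 0 ≠ 0 := by
      intro h₀
      have hu₁ : u 1 = 0 := by simpa [h₀, hb] using h₁
      exact hu (by ext1 i; fin_cases i <;> assumption)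
    have hq : A 0 0 + A 0 1 * (u 1 * (u 0)⁻¹) = q := by
      refine mul_right_cancel₀ h₀ ?_
      rw [← h₁, add_mul, mul_assoc, inv_mul_cancel_right₀ h₀]
    refine ⟨u 1 * (u 0)⁻¹, mul_right_cancel₀ h₀ ?_, hq⟩
    rw [hq, add_mul, mul_assoc, ← mul_assoc q, inv_mul_cancel_right₀ h₀, inv_mul_cancel_right₀ h₀, h₂]
  · rintro ⟨x, hx, rfl⟩
    exact ⟨![1, x], fun h ↦ one_ne_zero (congrFun h 0), by simp, by simpa using hx⟩

theorem left_eigenvalues_one_two_or_infinite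
    (A : Matrix (Fin 2) (Fin 2) ℍ[ℝ]) :
    {q : ℍ[ℝ] | ∃ u : Fin 2 → ℍ[ℝ], u ≠ 0 ∧
        A 0 0 * u 0 + A 0 1 * u 1 = q * u 0 ∧
        A 1 0 * u 0 + A 1 1 * u 1 = q * u 1}.Nonempty ∧
      ({q : ℍ[ℝ] | ∃ u : Fin 2 → ℍ[ℝ], u ≠ 0 ∧
        A 0 0 * u 0 + A 0 1 * u 1 = q * u 0 ∧
        A 1 0 * u 0 + A 1 1 * u 1 = q * u 1}.ncard = 1 ∨
       {q : ℍ[ℝ] | ∃ u : Fin 2 → ℍ[ℝ], u ≠ 0 ∧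
        A 0 0 * u 0 + A 0 1 * u 1 = q * u 0 ∧
        A 1 0 * u 0 + A 1 1 * u 1 = q * u 1}.ncard = 2 ∨
       {q : ℍ[ℝ] | ∃ u : Fin 2 → ℍ[ℝ], u ≠ 0 ∧
        A 0 0 * u 0 + A 0 1 * u 1 = q * u 0 ∧
        A 1 0 * u 0 + A 1 1 * u 1 = q * u 1}.Infinite) := by
  by_cases hb : A 0 1 = 0
  · rw [setOf_left_eigenvalue_of_triangular hb]
    refine ⟨Set.insert_nonempty _ _, ?_⟩
    by_cases h : A 0 0 = A 1 1
    · exact Or.inl (by simp [h])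
    · exact Or.inr (Or.inl (Set.ncard_pair h))
  · rw [setOf_left_eigenvalue_eq_image hb]
    have hinj : Function.Injective fun x ↦ A 0 0 + A 0 1 * x :=
      (add_right_injective _).comp (mul_right_injective₀ hb)
    refine ⟨Set.Nonempty.image _ (Quaternion.exists_quadratic_eq_zero _ _), ?_⟩
    rw [Set.ncard_image_of_injective _ hinj, Set.infinite_image_iff hinj.injOn]
    exact Quaternion.ncard_setOf_quadratic _ _
end

section
/- Let s, t ∈ ℝ with t² − 4s < 0. Then a quaternion p satisfies p² + t·p + s = 0 if and only if p = −t/2 + (√(4s − t²)/2)·ω for some pure quaternion ω of norm 1. In particular the equation has infinitely many quaternionic solutions. -/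
open Quaternion

theorem Quaternion.norm_eq_one_iff (a : ℍ[ℝ]) :
    ‖a‖ = 1 ↔ a.re ^ 2 + a.imI ^ 2 + a.imJ ^ 2 + a.imK ^ 2 = 1 := by
  rw [← Quaternion.normSq_def', Quaternion.normSq_eq_norm_mul_self, ← sq,
    pow_eq_one_iff_of_nonneg (norm_nonneg a) two_ne_zero]

theorem Quaternion.exists_pure_eq (x y z : ℝ) :
    ∃ a : ℍ[ℝ], a.re = 0 ∧ a.imI = x ∧ a.imJ = y ∧ a.imK = z :=
  ⟨(⟨0, x, y, z⟩ : QuaternionAlgebra ℝ (-1) 0 (-1)), rfl, rfl, rfl, rfl⟩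

theorem Quaternion.sq_add_coe_mul_add_coe_eq_zero_iff (s t : ℝ) (p : ℍ[ℝ]) :
    p ^ 2 + (t : ℍ[ℝ]) * p + (s : ℍ[ℝ]) = 0 ↔
      p.re ^ 2 - p.imI ^ 2 - p.imJ ^ 2 - p.imK ^ 2 + t * p.re + s = 0 ∧
        (2 * p.re + t) * p.imI = 0 ∧ (2 * p.re + t) * p.imJ = 0 ∧
          (2 * p.re + t) * p.imK = 0 := by
  rw [Quaternion.ext_iff]
  simp only [sq, Quaternion.re_add, Quaternion.imI_add, Quaternion.imJ_add, Quaternion.imK_add,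
    Quaternion.re_mul, Quaternion.imI_mul, Quaternion.imJ_mul, Quaternion.imK_mul,
    Quaternion.re_coe, Quaternion.imI_coe, Quaternion.imJ_coe, Quaternion.imK_coe,
    Quaternion.re_zero, Quaternion.imI_zero, Quaternion.imJ_zero, Quaternion.imK_zero]
  ring_nf

theorem Quaternion.quadratic_eq_zero_iff_of_discrim_neg
    (s t : ℝ) (h : t ^ 2 - 4 * s < 0) (p : ℍ[ℝ]) :
    p ^ 2 + (t : ℍ[ℝ]) * p + (s : ℍ[ℝ]) = 0
      ↔ ∃ ω : ℍ[ℝ], ω.re = 0 ∧ ‖ω‖ = 1 ∧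
          p = ((-t / 2 : ℝ) : ℍ[ℝ]) + ((Real.sqrt (4 * s - t ^ 2) / 2 : ℝ) : ℍ[ℝ]) * ω := by
  obtain ⟨d, hd⟩ : ∃ d, d = Real.sqrt (4 * s - t ^ 2) / 2 := ⟨_, rfl⟩
  have hd0 : 0 < d := by
    rw [hd]
    exact half_pos (Real.sqrt_pos.2 (by linarith))
  have hd2 : d ^ 2 = s - t ^ 2 / 4 := by
    rw [hd, div_pow, Real.sq_sqrt (by linarith)]
    ring
  rw [← hd, Quaternion.sq_add_coe_mul_add_coe_eq_zero_iff]
  constructor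
  · rintro ⟨h1, h2, h3, h4⟩
    have hre : 2 * p.re + t = 0 := by
      by_contra hne
      have e2 := (mul_eq_zero.1 h2).resolve_left hne
      have e3 := (mul_eq_zero.1 h3).resolve_left hne
      have e4 := (mul_eq_zero.1 h4).resolve_left hne
      rw [e2, e3, e4] at h1
      nlinarith [sq_nonneg (2 * p.re + t)]
    have hp : p.re = -t / 2 := by linarith
    obtain ⟨ω, h0, hI, hJ, hK⟩ := Quaternion.exists_pure_eq (p.imI / d) (p.imJ / d) (p.imK / d)
    refine ⟨ω, h0, ?_, ?_⟩
    · rw [Quaternion.norm_eq_one_iff, h0, hI, hJ, hK]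
      field_simp
      rw [hp] at h1
      linarith
    · rw [Quaternion.ext_iff]
      simp only [Quaternion.re_add, Quaternion.imI_add, Quaternion.imJ_add, Quaternion.imK_add,
        Quaternion.re_mul, Quaternion.imI_mul, Quaternion.imJ_mul, Quaternion.imK_mul,
        Quaternion.re_coe, Quaternion.imI_coe, Quaternion.imJ_coe, Quaternion.imK_coe,
        h0, hI, hJ, hK, hp]
      refine ⟨?_, ?_, ?_, ?_⟩ <;> field_simp <;> ring
  · rintro ⟨ω, h0, h1, rfl⟩
    rw [Quaternion.norm_eq_one_iff, h0] at h1
    simp only [Quaternion.re_add, Quaternion.imI_add, Quaternion.imJ_add, Quaternion.imK_add,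
      Quaternion.re_mul, Quaternion.imI_mul, Quaternion.imJ_mul, Quaternion.imK_mul,
      Quaternion.re_coe, Quaternion.imI_coe, Quaternion.imJ_coe, Quaternion.imK_coe, h0]
    refine ⟨?_, by ring, by ring, by ring⟩
    linear_combination (-d ^ 2) * h1 - hd2

theorem real_quadratic_negative_discriminant_solutions
    (s t : ℝ) (h : t ^ 2 - 4 * s < 0) :
    (∀ p : ℍ[ℝ],
        p ^ 2 + (t : ℍ[ℝ]) * p + (s : ℍ[ℝ]) = 0
          ↔ ∃ ω : ℍ[ℝ], ω.re = 0 ∧ ‖ω‖ = 1 ∧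
              p = ((-t / 2 : ℝ) : ℍ[ℝ]) + ((Real.sqrt (4 * s - t ^ 2) / 2 : ℝ) : ℍ[ℝ]) * ω) ∧
      {p : ℍ[ℝ] | p ^ 2 + (t : ℍ[ℝ]) * p + (s : ℍ[ℝ]) = 0}.Infinite := by
  refine ⟨Quaternion.quadratic_eq_zero_iff_of_discrim_neg s t h, ?_⟩
  have hd : Real.sqrt (4 * s - t ^ 2) / 2 ≠ 0 :=
    (half_pos (Real.sqrt_pos.2 (by linarith))).ne'
  choose ω h0 hI hJ hK using fun x : ℝ =>
    Quaternion.exists_pure_eq x (Real.sqrt (1 - x ^ 2)) 0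
  refine Set.infinite_of_injOn_mapsTo (s := Set.Icc (0 : ℝ) 1)
    (f := fun x => ((-t / 2 : ℝ) : ℍ[ℝ]) +
      ((Real.sqrt (4 * s - t ^ 2) / 2 : ℝ) : ℍ[ℝ]) * ω x)
    ?_ ?_ (Set.Icc_infinite zero_lt_one)
  · intro x _ y _ hxy
    have hxyI := (Quaternion.ext_iff.1 hxy).2.1
    simp only [Quaternion.imI_add, Quaternion.imI_mul, Quaternion.re_coe, Quaternion.imI_coe,
      Quaternion.imJ_coe, Quaternion.imK_coe, zero_mul, add_zero, zero_add, sub_zero, hI] at hxyI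
    exact mul_left_cancel₀ hd hxyI
  · rintro x ⟨hx0, hx1⟩
    refine (Quaternion.quadratic_eq_zero_iff_of_discrim_neg s t h _).2 ⟨ω x, h0 x, ?_, rfl⟩
    rw [Quaternion.norm_eq_one_iff, h0, hI, hJ, hK, Real.sq_sqrt (by nlinarith)]
    ring
end

section
/- Let A be a 2×2 symplectic quaternionic matrix (A*A = I). Then either A is diagonal, A = diag(α, δ) with |α| = |δ| = 1, or there exist quaternions α, β, γ with β ≠ 0, |α|² + |β|² = 1, |γ| = 1 such that A = [[α, −conj(β)·γ],[β, β·conj(α)·conj(β)·γ/|β|²]]. -/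
open Quaternion

theorem Quaternion.norm_sq_add_norm_sq_of_star_mul_self_add {p q : ℍ[ℝ]}
    (h : star p * p + star q * q = 1) : ‖p‖ ^ 2 + ‖q‖ ^ 2 = 1 := by
  rw [Quaternion.star_mul_self, Quaternion.star_mul_self, Quaternion.normSq_eq_norm_mul_self,
    Quaternion.normSq_eq_norm_mul_self] at h
  have h' : ((‖p‖ * ‖p‖ + ‖q‖ * ‖q‖ : ℝ) : ℍ[ℝ]) = ((1 : ℝ) : ℍ[ℝ]) := by
    push_cast at h ⊢
    exact h
  linarith [Quaternion.coe_injective h']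

theorem symplectic_matrix_form
    (A : Matrix (Fin 2) (Fin 2) ℍ[ℝ]) (hA : A.conjTranspose * A = 1) :
    (∃ α δ : ℍ[ℝ], ‖α‖ = 1 ∧ ‖δ‖ = 1 ∧ A = !![α, 0; 0, δ]) ∨
      (∃ α β γ : ℍ[ℝ], β ≠ 0 ∧ ‖α‖ ^ 2 + ‖β‖ ^ 2 = 1 ∧ ‖γ‖ = 1 ∧
        A = !![α, -(star β * γ);
               β, (‖β‖ ^ 2)⁻¹ • (β * star α * star β * γ)]) := by
  obtain ⟨a, b, c, d, rfl⟩ : ∃ a b c d, A = !![a, b; c, d] :=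
    ⟨_, _, _, _, Matrix.eta_fin_two A⟩
  have h00 : star a * a + star c * c = 1 := by
    simpa [Matrix.mul_apply, Fin.sum_univ_two] using congrFun (congrFun hA 0) 0
  have h01 : star a * b + star c * d = 0 := by
    simpa [Matrix.mul_apply, Fin.sum_univ_two] using congrFun (congrFun hA 0) 1
  have h11 : star b * b + star d * d = 1 := by
    simpa [Matrix.mul_apply, Fin.sum_univ_two] using congrFun (congrFun hA 1) 1
  have hac := Quaternion.norm_sq_add_norm_sq_of_star_mul_self_add h00
  have hbd := Quaternion.norm_sq_add_norm_sq_of_star_mul_self_add h11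
  by_cases hc : c = 0
  · subst hc
    have ha : ‖a‖ = 1 :=
      (pow_eq_one_iff_of_nonneg (norm_nonneg a) two_ne_zero).mp <| by
        rwa [norm_zero, zero_pow two_ne_zero, add_zero] at hac
    have ha0 : a ≠ 0 := by
      rintro rfl
      simp at ha
    obtain rfl : b = 0 := by simpa [ha0] using h01
    have hd : ‖d‖ = 1 :=
      (pow_eq_one_iff_of_nonneg (norm_nonneg d) two_ne_zero).mp <| by
        rwa [norm_zero, zero_pow two_ne_zero, zero_add] at hbd
    exact Or.inl ⟨a, d, ha, hd, rfl⟩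
  · right
    have hc' : star c ≠ 0 := by simpa using hc
    obtain ⟨γ, rfl⟩ : ∃ γ, b = -(star c * γ) :=
      ⟨-((star c)⁻¹ * b), by rw [mul_neg, neg_neg, mul_inv_cancel_left₀ hc']⟩
    have hcn : ‖c‖ ≠ 0 := norm_ne_zero_iff.mpr hc
    have hcd : star c * d = star a * (star c * γ) := by
      rw [mul_neg, neg_add_eq_zero] at h01
      exact h01.symm
    have hd : d = (‖c‖ ^ 2)⁻¹ • (c * star a * star c * γ) := by
      rw [mul_assoc, mul_assoc, ← hcd, ← mul_assoc, Quaternion.self_mul_star,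
        Quaternion.coe_mul_eq_smul, Quaternion.normSq_eq_norm_mul_self, smul_smul, ← sq,
        inv_mul_cancel₀ (pow_ne_zero 2 hcn), one_smul]
    have hdn : ‖d‖ = ‖a‖ * ‖γ‖ := by
      have h := congrArg norm hcd
      simp only [norm_mul, Quaternion.norm_star] at h
      exact mul_left_cancel₀ hcn (h.trans (by ring))
    refine ⟨a, c, γ, hc, hac, ?_, by rw [← hd]⟩
    rw [norm_neg, norm_mul, Quaternion.norm_star, hdn] at hbd
    have hγ : ‖γ‖ ^ 2 = 1 := by linear_combination hbd - ‖γ‖ ^ 2 * hac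
    exact (pow_eq_one_iff_of_nonneg (norm_nonneg γ) two_ne_zero).mp hγ
end

section
/- Let α, β ∈ ℍ with β ≠ 0 and |α|² + |β|² = 1, and set A₁ = (α, β) ∈ ℍ² and u = (−conj(β), β·conj(α)·conj(β)/|β|²) ∈ ℍ². Then |u| = 1, u is orthogonal to A₁ for the hermitian product ⟨v,w⟩ = conj(v₁)w₁ + conj(v₂)w₂, and every vector w ∈ ℍ² orthogonal to A₁ is of the form w = u·γ for some γ ∈ ℍ. -/
open Quaternion

theorem Quaternion.star_mul_self_eq_coe_norm_sq (q : ℍ[ℝ]) :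
    star q * q = ((‖q‖ ^ 2 : ℝ) : ℍ[ℝ]) := by
  rw [Quaternion.star_mul_self, Quaternion.normSq_eq_norm_mul_self, sq]

theorem Quaternion.inv_norm_sq_smul_mul_eq_inv_star_mul (β q : ℍ[ℝ]) :
    (‖β‖ ^ 2)⁻¹ • (β * q) = (star β)⁻¹ * q := by
  rw [Quaternion.inv_def, Quaternion.normSq_star, star_star, smul_mul_assoc,
    Quaternion.normSq_eq_norm_mul_self, sq]

theorem orthogonal_complement_of_unit_vector
    (α β : ℍ[ℝ]) (hβ : β ≠ 0) (hnorm : ‖α‖ ^ 2 + ‖β‖ ^ 2 = 1) :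
    star (-(star β)) * (-(star β)) +
        star ((‖β‖ ^ 2)⁻¹ • (β * star α * star β)) * ((‖β‖ ^ 2)⁻¹ • (β * star α * star β)) = 1 ∧
      star α * (-(star β)) + star β * ((‖β‖ ^ 2)⁻¹ • (β * star α * star β)) = 0 ∧
      ∀ w : Fin 2 → ℍ[ℝ], star α * w 0 + star β * w 1 = 0 →
        ∃ γ : ℍ[ℝ], w 0 = -(star β) * γ ∧ w 1 = ((‖β‖ ^ 2)⁻¹ • (β * star α * star β)) * γ := by
  have hb : star β ≠ 0 := star_ne_zero.mpr hβ
  have hβn : ‖β‖ ≠ 0 := norm_ne_zero_iff.mpr hβ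
  rw [mul_assoc β, Quaternion.inv_norm_sq_smul_mul_eq_inv_star_mul]
  refine ⟨?_, ?_, fun w hw => ⟨-((star β)⁻¹ * w 0), ?_, ?_⟩⟩
  · have hu : ‖(star β)⁻¹ * (star α * star β)‖ = ‖α‖ := by
      rw [norm_mul, norm_mul, norm_inv, norm_star, norm_star]
      field_simp
    rw [Quaternion.star_mul_self_eq_coe_norm_sq, Quaternion.star_mul_self_eq_coe_norm_sq, hu,
      norm_neg, norm_star, ← Quaternion.coe_add, add_comm, hnorm, Quaternion.coe_one]
  · rw [mul_inv_cancel_left₀ hb, mul_neg, neg_add_cancel]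
  · rw [neg_mul_neg, mul_inv_cancel_left₀ hb]
  · rw [mul_neg, mul_assoc, mul_assoc, mul_inv_cancel_left₀ hb, ← mul_neg,
      eq_inv_mul_iff_mul_eq₀ hb]
    exact eq_neg_of_add_eq_zero_right hw
end

section
/- Every left eigenvalue of a 2×2 symplectic quaternionic matrix has norm 1. -/
open Quaternion

/-- For a quaternionic vector, `star u ⬝ᵥ u` is the sum of the squared norms of its entries. -/
theorem Quaternion.star_dotProduct_self {ι : Type*} [Fintype ι] (u : ι → ℍ[ℝ]) :
    star u ⬝ᵥ u = ((∑ i, ‖u i‖ ^ 2 : ℝ) : ℍ[ℝ]) := by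
  rw [← Quaternion.algebraMap_def, map_sum]
  refine Finset.sum_congr rfl fun i _ => ?_
  rw [Pi.star_apply, Quaternion.star_mul_self, Quaternion.normSq_eq_norm_mul_self, sq,
    Quaternion.algebraMap_def]

/-- A symplectic quaternionic matrix preserves the sum of the squared norms of the entries. -/
theorem Quaternion.sum_norm_sq_mulVec {ι : Type*} [Fintype ι] [DecidableEq ι]
    {A : Matrix ι ι ℍ[ℝ]} (hA : A.conjTranspose * A = 1) (u : ι → ℍ[ℝ]) :
    ∑ i, ‖A.mulVec u i‖ ^ 2 = ∑ i, ‖u i‖ ^ 2 := by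
  have h : star (A.mulVec u) ⬝ᵥ A.mulVec u = star u ⬝ᵥ u := by
    rw [Matrix.star_mulVec, ← Matrix.dotProduct_mulVec, Matrix.mulVec_mulVec, hA,
      Matrix.one_mulVec]
  rw [Quaternion.star_dotProduct_self, Quaternion.star_dotProduct_self] at h
  exact Quaternion.coe_injective h

theorem left_eigenvalue_of_symplectic_has_norm_one
    (A : Matrix (Fin 2) (Fin 2) ℍ[ℝ]) (hA : A.conjTranspose * A = 1)
    (q : ℍ[ℝ])
    (hq : ∃ u : Fin 2 → ℍ[ℝ], u ≠ 0 ∧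
        A 0 0 * u 0 + A 0 1 * u 1 = q * u 0 ∧
        A 1 0 * u 0 + A 1 1 * u 1 = q * u 1) :
    ‖q‖ = 1 := by
  obtain ⟨u, hu, h0, h1⟩ := hq
  have hS : 0 < ∑ i, ‖u i‖ ^ 2 := by
    obtain ⟨i, hi⟩ := Function.ne_iff.mp hu
    exact Finset.sum_pos' (fun _ _ => by positivity)
      ⟨i, Finset.mem_univ i, pow_pos (norm_pos_iff.mpr hi) 2⟩
  have hAu : ∀ i, A.mulVec u i = q * u i := by
    simp [Fin.forall_fin_two, Matrix.mulVec, dotProduct, Fin.sum_univ_two, h0, h1]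
  have h := Quaternion.sum_norm_sq_mulVec hA u
  simp only [hAu, norm_mul, mul_pow, ← Finset.mul_sum] at h
  exact (pow_eq_one_iff_of_nonneg (norm_nonneg q) two_ne_zero).mp
    ((mul_eq_right₀ hS.ne').mp h)
end

section
/- A 2×2 symplectic quaternionic matrix A has infinitely many left eigenvalues if and only if there exist q ∈ ℍ with |q| = 1 and θ ∈ ℝ with sin θ ≠ 0 such that A = [[q·cos θ, −q·sin θ],[q·sin θ, q·cos θ]]. -/
open Quaternion

/-- Real parts of quaternions are invariant under conjugation. -/
theorem Quaternion.re_mul_mul_inv {w : ℍ[ℝ]} (hw : w ≠ 0) (x : ℍ[ℝ]) :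
    (w * x * w⁻¹).re = x.re := by
  have re_mul_comm : ∀ p q : ℍ[ℝ], (p * q).re = (q * p).re := by
    intro p q
    simp only [Quaternion.re_mul]
    ring
  rw [re_mul_comm, ← mul_assoc, inv_mul_cancel₀ hw, one_mul]

/-- Two distinct roots of a unilateral quadratic determine the real part of the linear coefficient
and the norm of the constant coefficient. -/
theorem Quaternion.vieta_of_ne {β γ x y : ℍ[ℝ]} (hxy : x ≠ y)
    (hx : x * x + β * x + γ = 0) (hy : y * y + β * y + γ = 0) :
    -β.re = x.re + y.re ∧ normSq γ = normSq x * normSq y := by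
  have hw : y - x ≠ 0 := sub_ne_zero.mpr hxy.symm
  have hmul : (y + β) * (y - x) = -((y - x) * x) := by
    have h : (y + β) * (y - x) + (y - x) * x =
        (y * y + β * y + γ) - (x * x + β * x + γ) := by noncomm_ring
    rw [hx, hy, sub_zero] at h
    exact eq_neg_of_add_eq_zero_left h
  have hyβ : y + β = -((y - x) * x * (y - x)⁻¹) := by
    rw [← neg_mul, ← hmul, mul_assoc, mul_inv_cancel₀ hw, mul_one]
  constructor
  · have h := congrArg QuaternionAlgebra.re hyβ
    have h' := Quaternion.re_mul_mul_inv hw x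
    simp only [Quaternion.re_add, Quaternion.re_neg] at h
    linarith
  · have hγ : γ = (y - x) * x * (y - x)⁻¹ * y := by
      have h : (y + β) * y + γ = 0 := by rw [add_mul]; exact hy
      rw [hyβ, neg_mul] at h
      exact (neg_add_eq_zero.mp h).symm
    have hn : normSq (y - x) ≠ 0 := by simpa using hw
    rw [hγ]
    simp only [map_mul, map_inv₀]
    field_simp

theorem Quaternion.mul_self_eq_s17 (x : ℍ[ℝ]) :
    x * x = ((2 * x.re : ℝ) : ℍ[ℝ]) * x - ((normSq x : ℝ) : ℍ[ℝ]) := by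
  rw [Quaternion.normSq_def']
  ext
  · simp only [re_mul, re_sub, re_coe, imI_coe, imJ_coe, imK_coe]
    ring
  · simp only [imI_mul, imI_sub, re_coe, imI_coe, imJ_coe, imK_coe]
    ring
  · simp only [imJ_mul, imJ_sub, re_coe, imI_coe, imJ_coe, imK_coe]
    ring
  · simp only [imK_mul, imK_sub, re_coe, imI_coe, imJ_coe, imK_coe]
    ring

/-- A unilateral quadratic over the quaternions with three distinct roots has real coefficients,
and its constant coefficient is nonnegative. -/
theorem Quaternion.real_coeffs_of_three_roots {β γ x y z : ℍ[ℝ]}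
    (hxy : x ≠ y) (hxz : x ≠ z) (hyz : y ≠ z)
    (hx : x * x + β * x + γ = 0) (hy : y * y + β * y + γ = 0) (hz : z * z + β * z + γ = 0) :
    ∃ r n : ℝ, 0 ≤ n ∧ β = (r : ℍ[ℝ]) ∧ γ = (n : ℍ[ℝ]) := by
  obtain ⟨t₁, n₁⟩ := vieta_of_ne hxy hx hy
  obtain ⟨t₂, n₂⟩ := vieta_of_ne hxz hx hz
  obtain ⟨t₃, n₃⟩ := vieta_of_ne hyz hy hz
  have hre : y.re = x.re := by linarith
  have hnorm : normSq y = normSq x := by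
    by_cases h : normSq z = 0
    · rw [h, mul_zero] at n₂
      rw [n₂, zero_eq_mul] at n₁
      have hz0 : z = 0 := by simpa using h
      rcases n₁ with h' | h'
      · exact absurd ((normSq_eq_zero.mp h').trans hz0.symm) hxz
      · exact absurd ((normSq_eq_zero.mp h').trans hz0.symm) hyz
    · exact mul_right_cancel₀ h (n₃.symm.trans n₂)
  have ex := Quaternion.mul_self_eq_s17 x
  have ey := Quaternion.mul_self_eq_s17 y
  rw [hre, hnorm] at ey
  rw [ex] at hx
  rw [ey] at hy
  have hT : (((2 * x.re : ℝ) : ℍ[ℝ]) + β) * (x - y) = 0 := by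
    rw [← sub_zero (0 : ℍ[ℝ])]
    nth_rw 1 [← hx]
    rw [← hy]
    noncomm_ring
  have hβ := (mul_eq_zero.mp hT).resolve_right (sub_ne_zero.mpr hxy)
  refine ⟨-(2 * x.re), normSq x, normSq_nonneg, ?_, ?_⟩
  · rw [coe_neg]
    exact eq_neg_of_add_eq_zero_right hβ
  · rw [sub_add_eq_add_sub, ← add_mul, hβ, zero_mul, zero_sub] at hx
    exact (neg_add_eq_zero.mp hx).symm

/-- The upper right and lower left entries of a symplectic matrix have the same norm. -/
theorem Quaternion.normSq_offDiag_eq {a b c d : ℍ[ℝ]}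
    (h₁ : normSq a + normSq c = 1) (h₂ : normSq b + normSq d = 1)
    (h₃ : star a * b + star c * d = 0) : normSq b = normSq c := by
  have h := congrArg normSq (eq_neg_of_add_eq_zero_left h₃)
  simp only [map_mul, normSq_neg, normSq_star] at h
  have ha : normSq a = 1 - normSq c := by linarith
  have hd : normSq d = 1 - normSq b := by linarith
  rw [ha, hd] at h
  linarith

theorem Quaternion.infinite_setOf_mul_self_eq_neg_one : {x : ℍ[ℝ] | x * x = -1}.Infinite := by
  have hunit : ∀ x : ℍ[ℝ], x.re = 0 → normSq x = 1 → x * x = -1 := by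
    intro x hre hnorm
    rw [mul_self_eq_s17, hre, hnorm, mul_zero, coe_zero, zero_mul, coe_one, zero_sub]
  refine Set.infinite_of_injOn_mapsTo (s := Set.Icc (0 : ℝ) 1)
    (f := fun t => (⟨0, t, Real.sqrt (1 - t ^ 2), 0⟩ : ℍ[ℝ])) ?_ ?_ (Set.Icc_infinite one_pos)
  · intro s _ t _ h
    exact congrArg QuaternionAlgebra.imI h
  · intro t ht
    have h : Real.sqrt (1 - t ^ 2) * Real.sqrt (1 - t ^ 2) = 1 - t ^ 2 :=
      Real.mul_self_sqrt (by nlinarith [ht.1, ht.2])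
    refine hunit _ rfl ((normSq_def' _).trans ?_)
    change (0 : ℝ) ^ 2 + t ^ 2 + Real.sqrt (1 - t ^ 2) ^ 2 + 0 ^ 2 = 1
    linarith

/-- A symplectic matrix with `b = -c * n` and `d = a + c * r`, where `r` and `0 ≤ n` are real and
`c ≠ 0`, is a unit quaternion times a planar rotation. -/
theorem Quaternion.exists_rotation {a b c d : ℍ[ℝ]} (hc : c ≠ 0)
    (h₁ : normSq a + normSq c = 1) (h₂ : normSq b + normSq d = 1)
    (h₃ : star a * b + star c * d = 0) {r n : ℝ} (hn : 0 ≤ n)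
    (hb : b = -(c * (n : ℍ[ℝ]))) (hd : d = a + c * (r : ℍ[ℝ])) :
    ∃ (q : ℍ[ℝ]) (θ : ℝ), ‖q‖ = 1 ∧ Real.sin θ ≠ 0 ∧
      a = q * ((Real.cos θ : ℝ) : ℍ[ℝ]) ∧ b = -(q * ((Real.sin θ : ℝ) : ℍ[ℝ])) ∧
      c = q * ((Real.sin θ : ℝ) : ℍ[ℝ]) ∧ d = q * ((Real.cos θ : ℝ) : ℍ[ℝ]) := by
  have hc0 : normSq c ≠ 0 := by simpa using hc
  have hbc := normSq_offDiag_eq h₁ h₂ h₃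
  have hn1 : n = 1 := by
    rw [hb, normSq_neg, map_mul, normSq_coe] at hbc
    have : n ^ 2 = 1 := mul_left_cancel₀ hc0 (by rw [hbc, mul_one])
    nlinarith
  subst hn1
  have hbc' : b = -c := by simpa using hb
  have hp : star c * a + ((normSq c * r : ℝ) : ℍ[ℝ]) = star (star c * a) := by
    rw [hbc', hd, mul_add, ← mul_assoc, star_mul_self] at h₃
    rw [star_mul, star_star, coe_mul, ← sub_eq_zero, ← h₃]
    noncomm_ring
  have hr : r = 0 := by
    have h := congrArg QuaternionAlgebra.re hp
    rw [re_add, re_star, re_coe] at h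
    have h' : normSq c * r = 0 := by linarith
    exact (mul_eq_zero.mp h').resolve_left hc0
  subst hr
  have hda : d = a := by simpa using hd
  have hreal : star c * a = ((star c * a).re : ℍ[ℝ]) :=
    star_eq_self.mp (by simpa using hp.symm)
  set m := (star c * a).re
  have hcpos : 0 < ‖c‖ := norm_pos_iff.mpr hc
  have hsq : normSq c = ‖c‖ * ‖c‖ := normSq_eq_norm_mul_self c
  have ha : a = c * ((m / normSq c : ℝ) : ℍ[ℝ]) := by
    have h : c * (star c * a) = c * (m : ℍ[ℝ]) := by rw [hreal]
    rw [← mul_assoc, self_mul_star] at h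
    have h' : ((normSq c : ℝ) : ℍ[ℝ]) ≠ 0 := fun h0 => hc0 (coe_injective h0)
    apply mul_left_cancel₀ h'
    rw [h, ← mul_assoc, coe_commutes, mul_assoc, ← coe_mul, mul_div_cancel₀ _ hc0]
  set k := m / normSq c * ‖c‖ with hk
  have hk2 : k ^ 2 + ‖c‖ ^ 2 = 1 := by
    have h := h₁
    rw [ha, map_mul, normSq_coe] at h
    rw [hk, ← h]
    nlinarith
  have hcos : Real.cos (Real.arccos k) = k :=
    Real.cos_arccos (by nlinarith) (by nlinarith)
  have hsin : Real.sin (Real.arccos k) = ‖c‖ := by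
    rw [Real.sin_arccos, show 1 - k ^ 2 = ‖c‖ ^ 2 by linarith, Real.sqrt_sq hcpos.le]
  have hq : c = c * ((‖c‖⁻¹ : ℝ) : ℍ[ℝ]) * ((‖c‖ : ℝ) : ℍ[ℝ]) := by
    rw [mul_assoc, ← coe_mul, inv_mul_cancel₀ hcpos.ne', coe_one, mul_one]
  have hqa : a = c * ((‖c‖⁻¹ : ℝ) : ℍ[ℝ]) * (k : ℍ[ℝ]) := by
    rw [mul_assoc, ← coe_mul, hk, mul_comm (m / normSq c), inv_mul_cancel_left₀ hcpos.ne', ← ha]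
  refine ⟨c * ((‖c‖⁻¹ : ℝ) : ℍ[ℝ]), Real.arccos k, ?_, ?_, ?_, ?_, ?_, ?_⟩
  · rw [norm_mul, norm_coe, norm_inv, norm_norm, mul_inv_cancel₀ hcpos.ne']
  · rw [hsin]; exact hcpos.ne'
  · rw [hcos]; exact hqa
  · rw [hsin, ← hq]; exact hbc'
  · rw [hsin]; exact hq
  · rw [hcos, hda]; exact hqa

theorem symplectic_infinite_left_eigenvalues_iff
    (A : Matrix (Fin 2) (Fin 2) ℍ[ℝ]) (hA : A.conjTranspose * A = 1) :
    {lam : ℍ[ℝ] | ∃ u : Fin 2 → ℍ[ℝ], u ≠ 0 ∧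
        A 0 0 * u 0 + A 0 1 * u 1 = lam * u 0 ∧
        A 1 0 * u 0 + A 1 1 * u 1 = lam * u 1}.Infinite
      ↔ ∃ (q : ℍ[ℝ]) (θ : ℝ), ‖q‖ = 1 ∧ Real.sin θ ≠ 0 ∧
          A = !![q * ((Real.cos θ : ℝ) : ℍ[ℝ]), -(q * ((Real.sin θ : ℝ) : ℍ[ℝ]));
                 q * ((Real.sin θ : ℝ) : ℍ[ℝ]), q * ((Real.cos θ : ℝ) : ℍ[ℝ])] := by
  constructor
  · intro hinf
    have e₁ := congrFun (congrFun hA 0) 0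
    have e₂ := congrFun (congrFun hA 1) 1
    have e₃ := congrFun (congrFun hA 0) 1
    simp only [Matrix.mul_apply, Fin.sum_univ_two, Matrix.conjTranspose_apply,
      Matrix.one_apply_eq, star_mul_self] at e₁ e₂
    simp only [Matrix.mul_apply, Fin.sum_univ_two, Matrix.conjTranspose_apply,
      Matrix.one_apply_ne zero_ne_one] at e₃
    have h₁ : normSq (A 0 0) + normSq (A 1 0) = 1 := by exact coe_injective (by simpa using e₁)
    have h₂ : normSq (A 0 1) + normSq (A 1 1) = 1 := by exact coe_injective (by simpa using e₂)
    have hbc := normSq_offDiag_eq h₁ h₂ e₃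
    have hu_ne : ∀ u : Fin 2 → ℍ[ℝ], u ≠ 0 → u 0 ≠ 0 ∨ u 1 ≠ 0 := by
      intro u hu
      by_contra! h
      exact hu (funext (Fin.forall_fin_two.mpr h))
    have hc : A 1 0 ≠ 0 := by
      intro hc
      have hb : A 0 1 = 0 := by simpa [hc] using hbc
      refine hinf (Set.Finite.subset (Set.toFinite {A 0 0, A 1 1}) ?_)
      rintro lam ⟨u, hu, hu₀, hu₁⟩
      simp only [hb, hc, zero_mul, add_zero, zero_add] at hu₀ hu₁
      rcases hu_ne u hu with h | h
      · exact Or.inl (mul_right_cancel₀ h hu₀).symm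
      · exact Or.inr (mul_right_cancel₀ h hu₁).symm
    have hroots : {x : ℍ[ℝ] | x * x + (A 1 0)⁻¹ * (A 1 1 - A 0 0) * x +
        -((A 1 0)⁻¹ * A 0 1) = 0}.Infinite := by
      refine Set.Infinite.of_image (fun x => A 1 0 * x + A 1 1) (hinf.mono ?_)
      rintro lam ⟨u, hu, hu₀, hu₁⟩
      have hu1 : u 1 ≠ 0 := by
        intro h
        rw [h, mul_zero, mul_zero, add_zero, mul_eq_zero] at hu₁
        exact (hu_ne u hu).elim (fun h' => h' (hu₁.resolve_left hc)) (fun h' => h' h)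
      have hlam : A 1 0 * (u 0 * (u 1)⁻¹) + A 1 1 = lam := by
        apply mul_right_cancel₀ hu1
        rw [← hu₁, add_mul, mul_assoc, mul_assoc, inv_mul_cancel₀ hu1, mul_one]
      have hx : A 0 0 * (u 0 * (u 1)⁻¹) + A 0 1 = lam * (u 0 * (u 1)⁻¹) := by
        apply mul_right_cancel₀ hu1
        rw [add_mul, mul_assoc, mul_assoc, mul_assoc, mul_assoc, inv_mul_cancel₀ hu1, mul_one, hu₀]
      refine ⟨u 0 * (u 1)⁻¹, ?_, hlam⟩
      generalize u 0 * (u 1)⁻¹ = x at hlam hx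
      rw [← hlam] at hx
      apply mul_left_cancel₀ hc
      rw [mul_zero, mul_add, mul_add, mul_neg, ← mul_assoc (A 1 0) (_ * _) x,
        mul_inv_cancel_left₀ hc, mul_inv_cancel_left₀ hc]
      rw [← sub_eq_zero] at hx
      rw [← neg_eq_zero, ← hx]
      noncomm_ring
    classical
    obtain ⟨s, hs, hcard⟩ := hroots.exists_subset_card_eq 3
    obtain ⟨x, y, z, hxy, hxz, hyz, rfl⟩ := Finset.card_eq_three.mp hcard
    obtain ⟨r, n, hn, hβ, hγ⟩ := real_coeffs_of_three_roots hxy hxz hyz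
      (hs (by simp)) (hs (by simp)) (hs (by simp))
    have hb : A 0 1 = -(A 1 0 * (n : ℍ[ℝ])) := by
      rw [← hγ, mul_neg, mul_inv_cancel_left₀ hc, neg_neg]
    have hd : A 1 1 = A 0 0 + A 1 0 * (r : ℍ[ℝ]) := by
      rw [← hβ, mul_inv_cancel_left₀ hc, add_sub_cancel]
    obtain ⟨q, θ, hq, hθ, ha', hb', hc', hd'⟩ := exists_rotation hc h₁ h₂ e₃ hn hb hd
    refine ⟨q, θ, hq, hθ, ?_⟩
    exact (Matrix.eta_fin_two A).trans (by rw [ha', hb', hc', hd'])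
  · rintro ⟨q, θ, hq, hθ, rfl⟩
    have hq0 : q ≠ 0 := by
      rintro rfl
      simp at hq
    have hS : ((Real.sin θ : ℝ) : ℍ[ℝ]) ≠ 0 := fun h0 => hθ (coe_injective h0)
    refine Set.infinite_of_injOn_mapsTo
      (f := fun x => q * (((Real.sin θ : ℝ) : ℍ[ℝ]) * x + ((Real.cos θ : ℝ) : ℍ[ℝ])))
      ?_ ?_ Quaternion.infinite_setOf_mul_self_eq_neg_one
    · intro x _ y _ h
      exact mul_left_cancel₀ hS (add_right_cancel (mul_left_cancel₀ hq0 h))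
    · intro x hx
      have hx : x * x = -1 := hx
      refine ⟨![x, 1], fun h => one_ne_zero (congrFun h 1), ?_, ?_⟩
      · simp [mul_assoc, add_mul, mul_add, hx, add_comm]
      · simp [mul_assoc, mul_add]
end

section
/- Let q ∈ ℍ with |q| = 1 and θ ∈ ℝ with sin θ ≠ 0, and let A = [[q·cos θ, −q·sin θ],[q·sin θ, q·cos θ]]. Then the set of left eigenvalues of A is exactly {q·(cos θ − (sin θ)·ω) : ω a pure quaternion with |ω| = 1}. -/
open Quaternion

/-- The imaginary units of `ℍ` are exactly the square roots of `-1`. -/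
theorem Quaternion.mul_self_eq_neg_one_iff (a : ℍ[ℝ]) :
    a * a = -1 ↔ a.re = 0 ∧ ‖a‖ = 1 := by
  constructor
  · intro h
    have hn : ‖a‖ = 1 := by
      have h1 : ‖a‖ * ‖a‖ = 1 := by rw [← norm_mul, h, norm_neg, norm_one]
      nlinarith [norm_nonneg a]
    refine ⟨Quaternion.sq_eq_neg_normSq.mp ?_, hn⟩
    rw [sq, h, Quaternion.normSq_eq_norm_mul_self, hn]
    simp
  · rintro ⟨hr, hn⟩
    rw [← sq, Quaternion.sq_eq_neg_normSq.mpr hr, Quaternion.normSq_eq_norm_mul_self, hn]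
    simp

theorem left_eigenvalues_of_rotation_type_symplectic
    (q : ℍ[ℝ]) (hq : ‖q‖ = 1) (θ : ℝ) (hθ : Real.sin θ ≠ 0) :
    {lam : ℍ[ℝ] | ∃ u : Fin 2 → ℍ[ℝ], u ≠ 0 ∧
        (q * ((Real.cos θ : ℝ) : ℍ[ℝ])) * u 0 + (-(q * ((Real.sin θ : ℝ) : ℍ[ℝ]))) * u 1
          = lam * u 0 ∧
        (q * ((Real.sin θ : ℝ) : ℍ[ℝ])) * u 0 + (q * ((Real.cos θ : ℝ) : ℍ[ℝ])) * u 1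
          = lam * u 1}
      = {lam : ℍ[ℝ] | ∃ ω : ℍ[ℝ], ω.re = 0 ∧ ‖ω‖ = 1 ∧
          lam = q * (((Real.cos θ : ℝ) : ℍ[ℝ]) - ((Real.sin θ : ℝ) : ℍ[ℝ]) * ω)} := by
  have hq0 : q ≠ 0 := by
    rintro rfl
    simp at hq
  have hs0 : ((Real.sin θ : ℝ) : ℍ[ℝ]) ≠ 0 := by
    intro h
    exact hθ (Quaternion.coe_injective (by simpa using h))
  generalize ((Real.sin θ : ℝ) : ℍ[ℝ]) = s at *
  generalize ((Real.cos θ : ℝ) : ℍ[ℝ]) = c at *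
  ext lam
  simp only [Set.mem_ofPred_eq]
  constructor
  · rintro ⟨u, hu, h0, h1⟩
    obtain ⟨ω, rfl⟩ : ∃ ω, lam = q * (c - s * ω) := by
      refine ⟨s⁻¹ * (c - q⁻¹ * lam), ?_⟩
      rw [mul_inv_cancel_left₀ hs0, sub_sub_cancel, mul_inv_cancel_left₀ hq0]
    have e0 : u 1 = ω * u 0 := by
      refine mul_left_cancel₀ hs0 (mul_left_cancel₀ hq0 ?_)
      rw [← sub_eq_zero] at h0 ⊢
      rw [← neg_eq_zero, ← h0]
      noncomm_ring
    have e1 : u 0 = -(ω * u 1) := by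
      refine mul_left_cancel₀ hs0 (mul_left_cancel₀ hq0 ?_)
      rw [← sub_eq_zero] at h1 ⊢
      rw [← h1]
      noncomm_ring
    have hu0 : u 0 ≠ 0 := by
      intro h
      refine hu (funext fun i => ?_)
      fin_cases i
      · exact h
      · simpa [h] using e0
    have hω : ω * ω = -1 := by
      refine mul_right_cancel₀ hu0 ?_
      rw [mul_assoc, ← e0, neg_one_mul, eq_neg_iff_add_eq_zero, add_comm]
      exact eq_neg_iff_add_eq_zero.mp e1
    obtain ⟨hr, hn⟩ := (Quaternion.mul_self_eq_neg_one_iff ω).mp hω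
    exact ⟨ω, hr, hn, rfl⟩
  · rintro ⟨ω, hr, hn, rfl⟩
    have hω := (Quaternion.mul_self_eq_neg_one_iff ω).mpr ⟨hr, hn⟩
    refine ⟨![1, ω], fun h => one_ne_zero (congrFun h 0), ?_, ?_⟩
    · simp only [Matrix.cons_val_zero, Matrix.cons_val_one]
      noncomm_ring
    · simp only [Matrix.cons_val_zero, Matrix.cons_val_one]
      have : q * (c - s * ω) * ω = q * c * ω - q * s * (ω * ω) := by noncomm_ring
      rw [this, hω]
      noncomm_ring
end
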